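/- arXiv:1801.02894 — 2 statements merged into one kernel-verified Lean document; each statement's English description precedes it below -/
import Mathlib

section
/- Let $I$ be a finite index set with $|I| \ge 1$, let $(\bar{\mathbf{x}}_i)_{i \in I}$ be vectors in $\mathbb{C}^{N_t}$, let $\bar{\mathbf{H}} : \mathbb{C}^{N_t} \to \mathbb{C}^{N_r}$ be a fixed linear map, let $N_r \ge 1$ be an integer, and for $\sigma > 0$ define $\mathcal{I}^{\mathrm{Low}}(\sigma) = 2\log_2 |I| + N_r \log_2 \tfrac{2}{e} - \log_2 \sum_{i \in I} \sum_{j \in I} \exp\!\left(-\frac{\|\bar{\mathbf{H}}(\bar{\mathbf{x}}_i - \bar{\mathbf{x}}_j)\|^2}{2\sigma^2}\right)$. Then (a) $\mathcal{I}^{\mathrm{Low}}(\sigma) \to N_r \log_2 \tfrac{2}{e}$ as $\sigma \to \infty$ (i.e. as SNR $\to 0$), and (b) if $\bar{\mathbf{H}}\bar{\mathbf{x}}_i \ne \bar{\mathbf{H}}\bar{\mathbf{x}}_j$ for all $i \ne j$, then $\mathcal{I}^{\mathrm{Low}}(\sigma) \to N_r \log_2 \tfrac{2}{e} + \log_2 |I|$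 as $\sigma \to 0^+$ (i.e. as SNR $\to \infty$). -/
open Real Filter

theorem tendsto_exp_neg_div_two_mul_sq_atTop (a : ℝ) :
    Tendsto (fun σ : ℝ => Real.exp (-a / (2 * σ ^ 2))) atTop (nhds 1) := by
  have hσ : Tendsto (fun σ : ℝ => 2 * σ ^ 2) atTop atTop :=
    (tendsto_pow_atTop two_ne_zero).const_mul_atTop two_pos
  simpa using (tendsto_const_nhds (x := -a)).div_atTop hσ |>.rexp

theorem tendsto_exp_neg_div_two_mul_sq_nhdsGT_zero {a : ℝ} (ha : 0 < a) :
    Tendsto (fun σ : ℝ => Real.exp (-a / (2 * σ ^ 2))) (nhdsWithin 0 (Set.Ioi 0)) (nhds 0) := by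
  have hinv : Tendsto (fun σ : ℝ => -a / 2 * (σ⁻¹) ^ 2) (nhdsWithin 0 (Set.Ioi 0)) atBot :=
    ((tendsto_pow_atTop two_ne_zero).comp tendsto_inv_nhdsGT_zero).const_mul_atTop_of_neg
      (by linarith)
  refine (Real.tendsto_exp_atBot.comp hinv).congr fun σ => ?_
  simp only [Function.comp_apply]
  congr 1
  rw [inv_pow, ← div_eq_mul_inv, div_div]

/-- extreme-SNR limits of the Jensen lower bound
`I^Low(σ) = 2 log₂|I| + N_r log₂(2/e) - log₂ ∑ᵢ∑ⱼ exp(-‖H(xᵢ-xⱼ)‖²/(2σ²))`: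
(a) as `σ → ∞`, `I^Low(σ) → N_r log₂(2/e)`; (b) if the channel images of the signal
points are distinct, then as `σ → 0⁺`, `I^Low(σ) → N_r log₂(2/e) + log₂|I|`. -/
theorem slm_mutual_info_lower_bound_limits
    {ι : Type*} [Fintype ι] [Nonempty ι]
    (Nt Nr : ℕ) (hNr : 1 ≤ Nr)
    (x : ι → EuclideanSpace ℂ (Fin Nt))
    (H : EuclideanSpace ℂ (Fin Nt) →ₗ[ℂ] EuclideanSpace ℂ (Fin Nr))
    (ILow : ℝ → ℝ)
    (hILow : ∀ σ : ℝ, ILow σ =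
      2 * Real.logb 2 (Fintype.card ι) + (Nr : ℝ) * Real.logb 2 (2 / Real.exp 1)
        - Real.logb 2 (∑ i : ι, ∑ j : ι,
            Real.exp (-‖H (x i - x j)‖ ^ 2 / (2 * σ ^ 2)))) :
    Tendsto ILow atTop (nhds ((Nr : ℝ) * Real.logb 2 (2 / Real.exp 1))) ∧
    ((∀ i j : ι, i ≠ j → H (x i) ≠ H (x j)) →
      Tendsto ILow (nhdsWithin 0 (Set.Ioi 0))
        (nhds ((Nr : ℝ) * Real.logb 2 (2 / Real.exp 1)
          + Real.logb 2 (Fintype.card ι)))) := by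
  classical
  have hcard : (Fintype.card ι : ℝ) ≠ 0 := Nat.cast_ne_zero.mpr Fintype.card_ne_zero
  have hlogb {l : Filter ℝ} {c : ℝ} (hc : c ≠ 0)
      (hsum : Tendsto (fun σ : ℝ => ∑ i : ι, ∑ j : ι,
        Real.exp (-‖H (x i - x j)‖ ^ 2 / (2 * σ ^ 2))) l (nhds c)) :
      Tendsto ILow l (nhds (2 * Real.logb 2 (Fintype.card ι) +
        (Nr : ℝ) * Real.logb 2 (2 / Real.exp 1) - Real.logb 2 c)) := by
    rw [funext hILow]
    exact ((Real.continuousAt_logb hc).tendsto.comp hsum).const_sub _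
  constructor
  · have hsum : Tendsto (fun σ : ℝ => ∑ i : ι, ∑ j : ι,
        Real.exp (-‖H (x i - x j)‖ ^ 2 / (2 * σ ^ 2))) atTop
        (nhds (Fintype.card ι * Fintype.card ι : ℝ)) := by
      simpa using tendsto_finsetSum Finset.univ fun i _ => tendsto_finsetSum Finset.univ
        fun j _ => tendsto_exp_neg_div_two_mul_sq_atTop (‖H (x i - x j)‖ ^ 2)
    convert hlogb (mul_ne_zero hcard hcard) hsum using 2
    rw [Real.logb_mul hcard hcard]
    ring
  · intro hH
    have hterm (i j : ι) : Tendsto (fun σ : ℝ =>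
        Real.exp (-‖H (x i - x j)‖ ^ 2 / (2 * σ ^ 2))) (nhdsWithin 0 (Set.Ioi 0))
        (nhds (if i = j then 1 else 0)) := by
      split_ifs with hij
      · simp [hij]
      · refine tendsto_exp_neg_div_two_mul_sq_nhdsGT_zero (pow_pos (norm_pos_iff.mpr ?_) 2)
        rw [map_sub]
        exact sub_ne_zero.mpr (hH i j hij)
    have hsum : Tendsto (fun σ : ℝ => ∑ i : ι, ∑ j : ι,
        Real.exp (-‖H (x i - x j)‖ ^ 2 / (2 * σ ^ 2))) (nhdsWithin 0 (Set.Ioi 0))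
        (nhds (Fintype.card ι : ℝ)) := by
      simpa using tendsto_finsetSum Finset.univ fun i _ => tendsto_finsetSum Finset.univ
        fun j _ => hterm i j
    convert hlogb hcard hsum using 2
    ring
end

section
/- Let $n \ge 1$, let $\hat{x} \in \mathbb{R}^n$, and let $f \in \mathbb{Z}^n$ satisfy $|\hat{x}_i - f_i| \le 1/2$ for all $i$ (componentwise nearest-integer rounding). Let $k$ be an index at which $|\hat{x}_i - f_i|$ is maximal, and define $g \in \mathbb{Z}^n$ by $g_i = f_i$ for $i \ne k$, $g_k = f_k + 1$ if $\hat{x}_k - f_k \ge 0$ and $g_k = f_k - 1$ otherwise. Let $q = f$ if $\sum_i f_i$ is even and $q = g$ otherwise. Then $q \in D_n = \{x \in \mathbb{Z}^n : \sum_i x_i \text{ even}\}$ and $\|\hat{x} - q\| \le \|\hat{x} - c\|$ for every $c \in D_n$; i.e., $q$ is a nearest point of the lattice $D_n$ to $\hat{x}$. -/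
/-- If `a` is a nearest integer to `x`, moving to another integer `c` increases the squared
error by at least `1 - 2 * |x - a|`. -/
lemma sq_sub_add_one_sub_le_of_ne {x : ℝ} {a c : ℤ} (h : |x - a| ≤ 1 / 2) (hc : c ≠ a) :
    (x - a) ^ 2 + (1 - 2 * |x - a|) ≤ (x - c) ^ 2 := by
  have hm : (1 : ℝ) ≤ |(c : ℝ) - a| := by
    exact_mod_cast Int.one_le_abs (sub_ne_zero.mpr hc)
  have hmul : (x - a) * (c - a) ≤ |x - a| * |(c : ℝ) - a| := by
    rw [← abs_mul]
    exact le_abs_self _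
  have hsq : |(c : ℝ) - a| ^ 2 = (c - a) ^ 2 := sq_abs _
  nlinarith [mul_nonneg (sub_nonneg.mpr hm)
    (by linarith : 0 ≤ |(c : ℝ) - a| + 1 - 2 * |x - a|)]

lemma sq_sub_le_sq_sub_of_abs_le_half {x : ℝ} {a : ℤ} (h : |x - a| ≤ 1 / 2) (c : ℤ) :
    (x - a) ^ 2 ≤ (x - c) ^ 2 := by
  rcases eq_or_ne c a with rfl | hc
  · exact le_rfl
  · linarith [sq_sub_add_one_sub_le_of_ne h hc]

/-- Rounding `x` the wrong way increases the squared error by exactly `1 - 2 * |x - a|`. -/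
lemma sq_sub_wrong_way (x : ℝ) (a : ℤ) :
    (x - ((if 0 ≤ x - a then a + 1 else a - 1 : ℤ) : ℝ)) ^ 2 =
      (x - a) ^ 2 + (1 - 2 * |x - a|) := by
  split_ifs with h
  · rw [abs_of_nonneg h]
    push_cast
    ring
  · rw [abs_of_neg (not_le.mp h)]
    push_cast
    ring

/-- correctness of the Conway--Sloane fast nearest-point quantizer for
the checkerboard lattice `Dₙ`: with `f` the componentwise nearest-integer rounding of
`xh`, `k` a coordinate of maximal rounding error, `g` equal to `f` except that `g k`
rounds the wrong way, and `q = f` if `∑ fᵢ` is even and `q = g` otherwise, the point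
`q` lies in `Dₙ` and is a nearest point of `Dₙ` to `xh`. -/
theorem conway_sloane_Dn_quantizer_correct
    (n : ℕ) (hn : 1 ≤ n) (xh : Fin n → ℝ) (f : Fin n → ℤ)
    (hf : ∀ i, |xh i - f i| ≤ 1 / 2)
    (k : Fin n) (hk : ∀ i, |xh i - f i| ≤ |xh k - f k|)
    (g : Fin n → ℤ)
    (hg₁ : ∀ i, i ≠ k → g i = f i)
    (hg₂ : g k = if 0 ≤ xh k - f k then f k + 1 else f k - 1)
    (q : Fin n → ℤ)
    (hq : q = if Even (∑ i, f i) then f else g) :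
    Even (∑ i, q i) ∧
    ∀ c : Fin n → ℤ, Even (∑ i, c i) →
      Real.sqrt (∑ i, (xh i - q i) ^ 2) ≤ Real.sqrt (∑ i, (xh i - c i) ^ 2) := by
  have sum_g : ∀ {M : Type} [AddCommMonoid M] (F : Fin n → ℤ → M),
      ∑ i, F i (g i) = F k (g k) + ∑ i ∈ Finset.univ.erase k, F i (f i) := by
    intro M _ F
    rw [← Finset.add_sum_erase _ _ (Finset.mem_univ k)]
    congr 1
    exact Finset.sum_congr rfl fun i hi => by rw [hg₁ i (Finset.ne_of_mem_erase hi)]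
  by_cases hE : Even (∑ i, f i)
  · rw [if_pos hE] at hq
    subst hq
    exact ⟨hE, fun c _ => Real.sqrt_le_sqrt <| Finset.sum_le_sum fun i _ =>
      sq_sub_le_sq_sub_of_abs_le_half (hf i) (c i)⟩
  rw [if_neg hE] at hq
  subst hq
  refine ⟨?_, fun c hc => Real.sqrt_le_sqrt ?_⟩
  · have hsum := sum_g fun _ z => z
    rw [hsum, hg₂]
    rw [← Finset.add_sum_erase _ _ (Finset.mem_univ k)] at hE
    split_ifs <;> grind
  · obtain ⟨j, hj⟩ : ∃ j, c j ≠ f j := by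
      by_contra! h
      exact hE (by simpa [h] using hc)
    rw [sum_g fun i z => (xh i - (z : ℝ)) ^ 2, hg₂, sq_sub_wrong_way, add_right_comm,
      Finset.add_sum_erase _ (fun i => (xh i - (f i : ℝ)) ^ 2) (Finset.mem_univ k),
      ← Finset.add_sum_erase _ _ (Finset.mem_univ j),
      ← Finset.add_sum_erase _ (fun i => (xh i - (c i : ℝ)) ^ 2) (Finset.mem_univ j)]
    have hrest : ∑ i ∈ Finset.univ.erase j, (xh i - (f i : ℝ)) ^ 2 ≤
        ∑ i ∈ Finset.univ.erase j, (xh i - (c i : ℝ)) ^ 2 :=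
      Finset.sum_le_sum fun i _ => sq_sub_le_sq_sub_of_abs_le_half (hf i) (c i)
    linarith [sq_sub_add_one_sub_le_of_ne (hf j) hj, hk j]
end
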